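/- Let R > 1, let t, t' be R-summable sequences of complex numbers, let σ : ℤ' → [0,1] satisfy Σ_{k∈ℤ', k<0} σ(k) < ∞, and let n ∈ ℤ. Then the Fredholm series of K_{t,t',σ} on ℤ' ∩ (n,∞) converges absolutely: Σ_{m≥0} (1/m!) Σ_{(x_1,...,x_m) ∈ (ℤ' ∩ (n,∞))^m} |det(K_{t,t',σ}(x_i,x_j))_{i,j=1}^m| < ∞. -/

import Mathlib

open scoped BigOperators

noncomputable section

/-- `t : ℕ → ℂ` encodes the sequence `(t_1, t_2, …)` via `t n = t_{n+1}`.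
`t` is `R`-summable if `∑_{n ≥ 1} |t_n| R^n < ∞`. -/
def RSummable (R : ℝ) (t : ℕ → ℂ) : Prop :=
  Summable fun n : ℕ => ‖t n‖ * R ^ (n + 1)

/-- `γ(z,t) = exp (∑_{n ≥ 1} t_n z^n)`. -/
def gammaFn (z : ℂ) (t : ℕ → ℂ) : ℂ :=
  Complex.exp (∑' n : ℕ, t n * z ^ (n + 1))

/-- `J(z;t,t') = exp (∑_{n ≥ 1} (t_n z^n − t'_n z^{-n}))`. -/
def Jfun (z : ℂ) (t t' : ℕ → ℂ) : ℂ :=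
  Complex.exp (∑' n : ℕ, (t n * z ^ (n + 1) - t' n * z⁻¹ ^ (n + 1)))

/-- `J_k(t,t')`, the `k`-th Laurent coefficient of `z ↦ J(z;t,t')`:
`J_k(t,t') = (1/(2π)) ∫ ₀^{2π} J(e^{iθ};t,t') e^{-ikθ} dθ`. -/
def Jcoef (t t' : ℕ → ℂ) (k : ℤ) : ℂ :=
  (2 * Real.pi : ℂ)⁻¹ *
    ∫ θ in (0:ℝ)..(2 * Real.pi),
      Jfun (Complex.exp (θ * Complex.I)) t t' * Complex.exp (-(k : ℂ) * θ * Complex.I)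

/-- The half-integer `a + 1/2 ∈ ℤ'` is encoded by the integer `a : ℤ`.
The kernel `K_{t,t',σ}(x,y) = ∑_{k ∈ ℤ'} σ(k) J_{x+k}(t,t') J_{-y-k}(-t,-t')`:
for `x = a + 1/2`, `y = b + 1/2`, `k = c + 1/2` one has `x + k = a + c + 1` and
`-y - k = -(b + c + 1)`. -/
def Kker (t t' : ℕ → ℂ) (σ : ℤ → ℝ) (a b : ℤ) : ℂ :=
  ∑' c : ℤ, (σ c : ℂ) * Jcoef t t' (a + c + 1) * Jcoef (-t) (-t') (-(b + c + 1))

/-- The indicator `1_{ℤ'_{>0}}` of the positive half-integers: `c + 1/2 > 0 ↔ 0 ≤ c`. -/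
def posInd : ℤ → ℝ := fun c => if 0 ≤ c then 1 else 0

/-- `Z_{t,t'} = exp (∑_{n ≥ 1} n t_n t'_n)`. -/
def Zconst (t t' : ℕ → ℂ) : ℂ :=
  Complex.exp (∑' n : ℕ, (n + 1 : ℂ) * t n * t' n)

/-- The Fredholm series `D_n` of a kernel `K` on `ℓ²(ℤ' ∩ (n,∞))`; the half-integer
`a + 1/2` belongs to `(n,∞)` iff `n ≤ a`. -/
def fredholmSeries (K : ℤ → ℤ → ℂ) (n : ℤ) : ℂ :=
  ∑' m : ℕ, ((-1 : ℂ) ^ m / m.factorial) *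
    ∑' x : Fin m → {a : ℤ // n ≤ a},
      Matrix.det (Matrix.of fun i j : Fin m => K (x i) (x j))

/-- Absolute convergence of the Fredholm series of `K` on `ℓ²(ℤ' ∩ (n,∞))`. -/
def FredholmAbsConv (K : ℤ → ℤ → ℂ) (n : ℤ) : Prop :=
  (∀ m : ℕ, Summable fun x : Fin m → {a : ℤ // n ≤ a} =>
      ‖Matrix.det (Matrix.of fun i j : Fin m => K (x i) (x j))‖) ∧
    Summable fun m : ℕ => (m.factorial : ℝ)⁻¹ *
      ∑' x : Fin m → {a : ℤ // n ≤ a},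
        ‖Matrix.det (Matrix.of fun i j : Fin m => K (x i) (x j))‖

/-- `τ_n(t,t';σ) = Z_{t,t'} · D_n(t,t';σ)`. -/
def tauFn (σ : ℤ → ℝ) (t t' : ℕ → ℂ) (n : ℤ) : ℂ :=
  Zconst t t' * fredholmSeries (Kker t t' σ) n

/-- `{z} = (z, z²/2, z³/3, …)`. -/
def chargeSeq (z : ℂ) : ℕ → ℂ := fun n => z ^ (n + 1) / (n + 1)

/-- `h_k(t)`: the Taylor coefficients of `γ(·,t)`, with `h_k(t) = 0` for `k < 0`. -/
def hcoef (t : ℕ → ℂ) (k : ℤ) : ℂ :=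
  if k < 0 then 0 else
    (2 * Real.pi : ℂ)⁻¹ *
      ∫ θ in (0:ℝ)..(2 * Real.pi),
        gammaFn (Complex.exp (θ * Complex.I)) t * Complex.exp (-(k : ℂ) * θ * Complex.I)

/-- Young diagrams (partitions): `part i` is the `(i+1)`-st part `λ_{i+1}`. -/
structure Partition' where
  part : ℕ → ℕ
  antitone : Antitone part
  ev_zero : ∃ N, ∀ i ≥ N, part i = 0

/-- The number `ℓ(λ)` of nonzero parts. -/
def Partition'.len (lam : Partition') : ℕ := sInf {N | lam.part N = 0}

/-- `s_λ(t) = det (h_{λ_i − i + j}(t))_{i,j = 1}^{ℓ(λ)}` (Jacobi–Trudi). -/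
def schurPoly (t : ℕ → ℂ) (lam : Partition') : ℂ :=
  Matrix.det (Matrix.of fun i j : Fin lam.len =>
    hcoef t ((lam.part i : ℤ) + (j : ℤ) - (i : ℤ)))

/-- `S_0(λ) = {λ_i − i + 1/2 : i ≥ 1} ⊂ ℤ'` in integer coordinates
(`a : ℤ` encodes the half-integer `a + 1/2`). -/
def S0 (lam : Partition') : Set ℤ := {a : ℤ | ∃ i : ℕ, a = (lam.part i : ℤ) - (i + 1)}

/-- The multiplicative functional `∏_{x ∈ S_0(λ)} (1 − σ(x − n))
  = ∏_{i ≥ 1} (1 − σ(λ_i − i + 1/2 − n))`. -/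
def multFunc (σ : ℤ → ℝ) (n : ℤ) (lam : Partition') : ℝ :=
  ∏' i : ℕ, (1 - σ ((lam.part i : ℤ) - (i + 1) - n))

open scoped ENNReal

theorem RSummable.neg {R : ℝ} {t : ℕ → ℂ} (ht : RSummable R t) : RSummable R (-t) := by
  simpa [RSummable] using ht

theorem norm_Jfun_term_le {R : ℝ} (t t' : ℕ → ℂ) {z : ℂ} (hz : ‖z‖ ≤ R) (hz' : ‖z⁻¹‖ ≤ R)
    (n : ℕ) :
    ‖t n * z ^ (n + 1) - t' n * z⁻¹ ^ (n + 1)‖ ≤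
      ‖t n‖ * R ^ (n + 1) + ‖t' n‖ * R ^ (n + 1) := by
  refine (norm_sub_le _ _).trans ?_
  rw [norm_mul, norm_mul, norm_pow, norm_pow]
  gcongr

theorem norm_Jfun_le {R : ℝ} {t t' : ℕ → ℂ} (ht : RSummable R t) (ht' : RSummable R t')
    {z : ℂ} (hz : ‖z‖ ≤ R) (hz' : ‖z⁻¹‖ ≤ R) :
    ‖Jfun z t t'‖ ≤ Real.exp (∑' n : ℕ, (‖t n‖ * R ^ (n + 1) + ‖t' n‖ * R ^ (n + 1))) := by
  refine (Complex.norm_exp_le_exp_norm _).trans (Real.exp_le_exp.2 ?_)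
  exact tsum_of_norm_bounded (ht.add ht').hasSum (norm_Jfun_term_le t t' hz hz')

theorem differentiableAt_Jfun {R : ℝ} {t t' : ℕ → ℂ} (ht : RSummable R t)
    (ht' : RSummable R t') {z : ℂ} (hz0 : z ≠ 0) (hz : ‖z‖ < R) (hz' : ‖z⁻¹‖ < R) :
    DifferentiableAt ℂ (fun z => Jfun z t t') z := by
  have hopen : IsOpen {z : ℂ | z ≠ 0 ∧ ‖z‖ < R ∧ 1 < R * ‖z‖} :=
    (isOpen_ne_fun continuous_id continuous_const).inter
      ((isOpen_lt continuous_norm continuous_const).inter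
        (isOpen_lt continuous_const (continuous_const.mul continuous_norm)))
  have inv_lt {w : ℂ} (hw : w ≠ 0) : ‖w⁻¹‖ < R ↔ 1 < R * ‖w‖ := by
    rw [norm_inv, inv_lt_iff_one_lt_mul₀ (norm_pos_iff.2 hw)]
  have hdiff := Complex.differentiableOn_tsum_of_summable_norm
    (F := fun (n : ℕ) (z : ℂ) => t n * z ^ (n + 1) - t' n * z⁻¹ ^ (n + 1))
    (ht.add ht') (fun n w hw => by
      have hw0 : w ≠ 0 := hw.1
      refine DifferentiableAt.differentiableWithinAt ?_
      fun_prop (disch := assumption)) hopen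
    (fun n w hw => norm_Jfun_term_le t t' hw.2.1.le ((inv_lt hw.1).2 hw.2.2).le n)
  exact (hdiff.differentiableAt (hopen.mem_nhds ⟨hz0, hz, (inv_lt hz0).1 hz'⟩)).cexp

theorem Jcoef_eq_circleIntegral (t t' : ℕ → ℂ) (k : ℤ) :
    Jcoef t t' k =
      (2 * Real.pi * Complex.I : ℂ)⁻¹ • ∮ z in C(0, 1), Jfun z t t' * z ^ (-k - 1) := by
  have h : (∮ z in C(0, 1), Jfun z t t' * z ^ (-k - 1)) =
      Complex.I * ∫ θ in (0:ℝ)..(2 * Real.pi),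
        Jfun (Complex.exp (θ * Complex.I)) t t' * Complex.exp (-(k : ℂ) * θ * Complex.I) := by
    rw [circleIntegral, ← intervalIntegral.integral_const_mul]
    refine intervalIntegral.integral_congr fun θ _ => ?_
    have hexp : Complex.exp (θ * Complex.I) * Complex.exp (θ * Complex.I) ^ (-k - 1) =
        Complex.exp (-(k : ℂ) * θ * Complex.I) := by
      rw [← zpow_one_add₀ (Complex.exp_ne_zero _), ← Complex.exp_int_mul]
      congr 1
      push_cast
      ring
    simp only [deriv_circleMap, circleMap, Complex.ofReal_one, one_mul, zero_add, smul_eq_mul]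
    rw [← hexp]
    ring
  rw [h, Jcoef, smul_eq_mul, mul_inv (2 * Real.pi : ℂ) Complex.I, mul_assoc,
    inv_mul_cancel_left₀ Complex.I_ne_zero]

theorem circleIntegral_Jfun_eq {R : ℝ} {t t' : ℕ → ℂ} (ht : RSummable R t)
    (ht' : RSummable R t') (k : ℤ) {r₁ r₂ : ℝ} (h₁ : R⁻¹ < r₁) (h₁₂ : r₁ ≤ r₂) (h₂ : r₂ < R)
    (hr : 0 < r₁) :
    (∮ z in C(0, r₂), Jfun z t t' * z ^ k) = ∮ z in C(0, r₁), Jfun z t t' * z ^ k := by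
  have hdiff : ∀ z ∈ Metric.closedBall (0 : ℂ) r₂ \ Metric.ball 0 r₁,
      DifferentiableAt ℂ (fun z => Jfun z t t' * z ^ k) z := by
    rintro z ⟨hz₂, hz₁⟩
    rw [mem_closedBall_zero_iff] at hz₂
    rw [mem_ball_zero_iff, not_lt] at hz₁
    have hz0 : z ≠ 0 := norm_pos_iff.1 (hr.trans_le hz₁)
    refine (differentiableAt_Jfun ht ht' hz0 (hz₂.trans_lt h₂) ?_).mul
      (differentiableAt_zpow.2 (.inl hz0))
    rw [norm_inv]
    exact inv_lt_of_inv_lt₀ (hr.trans_le (h₁₂.trans h₂.le)) (h₁.trans_le hz₁)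
  refine Complex.circleIntegral_eq_of_differentiable_on_annulus_off_countable hr h₁₂
    Set.countable_empty (fun z hz => (hdiff z hz).continuousAt.continuousWithinAt) ?_
  rintro z ⟨⟨hz₂, hz₁⟩, -⟩
  exact hdiff z ⟨Metric.ball_subset_closedBall hz₂,
    fun h => hz₁ (Metric.ball_subset_closedBall h)⟩

theorem norm_Jcoef_le {R : ℝ} {t t' : ℕ → ℂ} (ht : RSummable R t) (ht' : RSummable R t')
    {r : ℝ} (hr : 1 < r) (hrR : r < R) (k : ℤ) :
    ‖Jcoef t t' k‖ ≤
      Real.exp (∑' n : ℕ, (‖t n‖ * R ^ (n + 1) + ‖t' n‖ * R ^ (n + 1))) * r⁻¹ ^ k.natAbs := by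
  have hr0 : 0 < r := one_pos.trans hr
  have hR0 : 0 < R := hr0.trans hrR
  have hinv : R⁻¹ < r⁻¹ := inv_strictAnti₀ hr0 hrR
  have hinv1 : r⁻¹ < 1 := inv_lt_one_of_one_lt₀ hr
  have key (ρ : ℝ) (hρ₁ : r⁻¹ ≤ ρ) (hρ₂ : ρ ≤ r)
      (hρ : (∮ z in C(0, ρ), Jfun z t t' * z ^ (-k - 1)) =
        ∮ z in C(0, 1), Jfun z t t' * z ^ (-k - 1)) :
      ‖Jcoef t t' k‖ ≤
        Real.exp (∑' n : ℕ, (‖t n‖ * R ^ (n + 1) + ‖t' n‖ * R ^ (n + 1))) * ρ ^ (-k) := by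
    have hρ0 : 0 < ρ := (inv_pos.2 hr0).trans_le hρ₁
    rw [Jcoef_eq_circleIntegral, ← hρ]
    refine (circleIntegral.norm_two_pi_i_inv_smul_integral_le_of_norm_le_const hρ0.le
      (C := Real.exp (∑' n : ℕ, (‖t n‖ * R ^ (n + 1) + ‖t' n‖ * R ^ (n + 1))) *
        ρ ^ (-k - 1)) fun z hz => ?_).trans_eq ?_
    · rw [mem_sphere_zero_iff_norm] at hz
      rw [norm_mul, norm_zpow, hz]
      gcongr
      refine norm_Jfun_le ht ht' (hz.trans_le (hρ₂.trans hrR.le)) ?_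
      rw [norm_inv, hz]
      exact inv_le_of_inv_le₀ hR0 (hinv.le.trans hρ₁)
    · rw [mul_left_comm, ← zpow_one_add₀ hρ0.ne']
      congr 2
      ring
  rcases le_total 0 k with hk | hk
  · refine (key r (hinv1.le.trans hr.le) le_rfl
      (circleIntegral_Jfun_eq ht ht' _ (hinv.trans hinv1) hr.le hrR one_pos)).trans_eq ?_
    rw [zpow_neg, ← inv_zpow, ← zpow_natCast, Int.natAbs_of_nonneg hk]
  · refine (key r⁻¹ le_rfl (hinv1.le.trans hr.le)
      (circleIntegral_Jfun_eq ht ht' _ hinv hinv1.le (hr.trans hrR) (inv_pos.2 hr0)).symm).trans_eq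
      ?_
    rw [← zpow_natCast, Int.ofNat_natAbs_of_nonpos hk]

theorem enorm_Jcoef_le {R : ℝ} {t t' : ℕ → ℂ} (ht : RSummable R t) (ht' : RSummable R t')
    {r : ℝ} (hr : 1 < r) (hrR : r < R) :
    ∃ C : ℝ≥0∞, C ≠ ⊤ ∧ ∀ k, ‖Jcoef t t' k‖ₑ ≤ C * ENNReal.ofReal r⁻¹ ^ k.natAbs := by
  refine ⟨ENNReal.ofReal (Real.exp
    (∑' n : ℕ, (‖t n‖ * R ^ (n + 1) + ‖t' n‖ * R ^ (n + 1)))), ENNReal.ofReal_ne_top, fun k => ?_⟩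
  have hr0 : 0 ≤ r⁻¹ := inv_nonneg.2 (zero_le_one.trans hr.le)
  rw [← ofReal_norm, ← ENNReal.ofReal_pow hr0, ← ENNReal.ofReal_mul (Real.exp_pos _).le]
  exact ENNReal.ofReal_le_ofReal (norm_Jcoef_le ht ht' hr hrR k)

theorem tsum_pow_natAbs_ne_top {q : ℝ≥0∞} (hq : q < 1) : ∑' k : ℤ, q ^ k.natAbs ≠ ⊤ := by
  have hgeom : ∑' n : ℕ, q ^ n ≠ ⊤ := by
    rw [ENNReal.tsum_geometric]
    exact ENNReal.inv_ne_top.2 (tsub_pos_of_lt hq).ne'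
  have hneg : ∑' n : ℕ, q ^ (-((n : ℤ) + 1)).natAbs ≤ ∑' n : ℕ, q ^ n :=
    ENNReal.tsum_le_tsum fun n => pow_le_pow_right_of_le_one' hq.le (by omega)
  rw [tsum_of_nat_of_neg_add_one ENNReal.summable ENNReal.summable]
  exact ENNReal.add_ne_top.2 ⟨hgeom, ne_top_of_le_ne_top hgeom hneg⟩

theorem tsum_add_pow_natAbs (q : ℝ≥0∞) (m : ℤ) :
    ∑' k : ℤ, q ^ (k + m).natAbs = ∑' k : ℤ, q ^ k.natAbs :=
  (Equiv.addRight m).tsum_eq fun k : ℤ => q ^ k.natAbs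

theorem pow_natAbs_add_le {q : ℝ≥0∞} (hq0 : q ≠ 0) (hq : q < 1) {n a c : ℤ} (ha : n ≤ a)
    (hc : 0 ≤ c) :
    q ^ (a + c + 1).natAbs ≤
      (q ^ (2 * n.natAbs))⁻¹ * (q ^ a.natAbs * q ^ c.natAbs) := by
  rw [mul_comm, ← div_eq_mul_inv,
    ENNReal.le_div_iff_mul_le (.inl (pow_ne_zero _ hq0)) (.inl (ENNReal.pow_ne_top hq.ne_top)),
    ← pow_add, ← pow_add]
  exact pow_le_pow_right_of_le_one' hq.le (by omega)

theorem tsum_weight_mul_pow_natAbs_ne_top {q : ℝ≥0∞} (hq0 : q ≠ 0) (hq : q < 1)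
    {s : ℤ → ℝ≥0∞} (hs1 : ∀ c, s c ≤ 1) (hs : ∑' c : {c : ℤ // c < 0}, s c ≠ ⊤) (n : ℤ) :
    ∑' c : ℤ, s c * ∑' a : {a : ℤ // n ≤ a}, q ^ ((a : ℤ) + c + 1).natAbs ≠ ⊤ := by
  set D : ℝ≥0∞ := ∑' k : ℤ, q ^ k.natAbs with hD
  have hDtop : D ≠ ⊤ := tsum_pow_natAbs_ne_top hq
  have hbound (c : ℤ) : s c * ∑' a : {a : ℤ // n ≤ a}, q ^ ((a : ℤ) + c + 1).natAbs ≤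
      Set.indicator {c | c < 0} s c * D + (q ^ (2 * n.natAbs))⁻¹ * D * q ^ c.natAbs := by
    rcases lt_or_ge c 0 with hc | hc
    · refine le_add_right ?_
      rw [Set.indicator_of_mem (by exact hc)]
      gcongr
      refine (ENNReal.tsum_comp_le_tsum_of_injective Subtype.val_injective
        fun a : ℤ => q ^ (a + c + 1).natAbs).trans_eq ?_
      simp_rw [add_assoc, tsum_add_pow_natAbs, hD]
    · refine le_add_left ((mul_le_of_le_one_left' (hs1 c)).trans ?_)
      calc ∑' a : {a : ℤ // n ≤ a}, q ^ ((a : ℤ) + c + 1).natAbs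
          ≤ ∑' a : {a : ℤ // n ≤ a},
              (q ^ (2 * n.natAbs))⁻¹ * (q ^ (a : ℤ).natAbs * q ^ c.natAbs) :=
            ENNReal.tsum_le_tsum fun a => pow_natAbs_add_le hq0 hq a.2 hc
        _ = (q ^ (2 * n.natAbs))⁻¹ *
              (∑' a : {a : ℤ // n ≤ a}, q ^ (a : ℤ).natAbs) * q ^ c.natAbs := by
            rw [ENNReal.tsum_mul_left, ENNReal.tsum_mul_right, mul_assoc]
        _ ≤ (q ^ (2 * n.natAbs))⁻¹ * D * q ^ c.natAbs := by
            gcongr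
            exact ENNReal.tsum_comp_le_tsum_of_injective Subtype.val_injective
              fun a : ℤ => q ^ a.natAbs
  refine ne_top_of_le_ne_top ?_ (ENNReal.tsum_le_tsum hbound)
  rw [ENNReal.tsum_add, ENNReal.tsum_mul_right, ENNReal.tsum_mul_left, ← hD, ← tsum_subtype]
  exact ENNReal.add_ne_top.2 ⟨ENNReal.mul_ne_top hs hDtop, ENNReal.mul_ne_top
    (ENNReal.mul_ne_top (ENNReal.inv_ne_top.2 (pow_ne_zero _ hq0)) hDtop) hDtop⟩

theorem enorm_Kker_le (t t' : ℕ → ℂ) (σ : ℤ → ℝ) (a b : ℤ) :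
    ‖Kker t t' σ a b‖ₑ ≤ ∑' c : ℤ,
      ‖σ c‖ₑ * ‖Jcoef t t' (a + c + 1)‖ₑ * ‖Jcoef (-t) (-t') (-(b + c + 1))‖ₑ := by
  refine enorm_tsum_le_tsum_enorm.trans_eq (tsum_congr fun c => ?_)
  rw [enorm_mul, enorm_mul, ← ofReal_norm (σ c : ℂ), Complex.norm_real, ofReal_norm]

theorem tsum_enorm_Kker_ne_top {R : ℝ} (hR : 1 < R) {t t' : ℕ → ℂ}
    (ht : RSummable R t) (ht' : RSummable R t')
    {σ : ℤ → ℝ} (hσ01 : ∀ k, σ k ∈ Set.Icc (0:ℝ) 1)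
    (hσsum : Summable fun k : {k : ℤ // k < 0} => σ k) (n : ℤ) :
    ∑' a : {a : ℤ // n ≤ a}, ∑' b : ℤ, ‖Kker t t' σ a b‖ₑ ≠ ⊤ := by
  obtain ⟨r, hr, hrR⟩ := exists_between hR
  obtain ⟨C₁, hC₁, hJ₁⟩ := enorm_Jcoef_le ht ht' hr hrR
  obtain ⟨C₂, hC₂, hJ₂⟩ := enorm_Jcoef_le ht.neg ht'.neg hr hrR
  set q : ℝ≥0∞ := ENNReal.ofReal r⁻¹
  have hq0 : q ≠ 0 := (ENNReal.ofReal_pos.2 (inv_pos.2 (one_pos.trans hr))).ne'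
  have hq1 : q < 1 := ENNReal.ofReal_lt_one.2 (inv_lt_one_of_one_lt₀ hr)
  have hs1 (c : ℤ) : ‖σ c‖ₑ ≤ 1 := by
    rw [Real.enorm_of_nonneg (hσ01 c).1]
    exact ENNReal.ofReal_le_one.2 (hσ01 c).2
  have hs : ∑' c : {c : ℤ // c < 0}, ‖σ c‖ₑ ≠ ⊤ :=
    tsum_enorm_ne_top_iff_summable_norm.2 hσsum.norm
  have hbound (a b : ℤ) : ‖Kker t t' σ a b‖ₑ ≤
      ∑' c : ℤ, C₁ * C₂ * (‖σ c‖ₑ * q ^ (a + c + 1).natAbs * q ^ (b + (c + 1)).natAbs) := by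
    refine (enorm_Kker_le t t' σ a b).trans (ENNReal.tsum_le_tsum fun c => ?_)
    have h₂ := hJ₂ (-(b + c + 1))
    rw [Int.natAbs_neg, add_assoc] at h₂
    calc _ ≤ ‖σ c‖ₑ * (C₁ * q ^ (a + c + 1).natAbs) * (C₂ * q ^ (b + (c + 1)).natAbs) := by
          gcongr
          · exact hJ₁ _
          · rwa [add_assoc]
      _ = _ := by ring
  refine ne_top_of_le_ne_top ?_
    (ENNReal.tsum_le_tsum fun a : {a : ℤ // n ≤ a} => ENNReal.tsum_le_tsum fun b => hbound a b)
  have heq (a : {a : ℤ // n ≤ a}) :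
      ∑' (b : ℤ) (c : ℤ),
        C₁ * C₂ * (‖σ c‖ₑ * q ^ ((a : ℤ) + c + 1).natAbs * q ^ (b + (c + 1)).natAbs) =
      C₁ * C₂ * ((∑' c : ℤ, ‖σ c‖ₑ * q ^ ((a : ℤ) + c + 1).natAbs) *
        ∑' k : ℤ, q ^ k.natAbs) := by
    rw [ENNReal.tsum_comm]
    simp_rw [ENNReal.tsum_mul_left, tsum_add_pow_natAbs, ENNReal.tsum_mul_right]
  simp_rw [heq, ENNReal.tsum_mul_left, ENNReal.tsum_mul_right]
  rw [ENNReal.tsum_comm]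
  simp_rw [ENNReal.tsum_mul_left]
  exact ENNReal.mul_ne_top (ENNReal.mul_ne_top hC₁ hC₂) (ENNReal.mul_ne_top
    (tsum_weight_mul_pow_natAbs_ne_top hq0 hq1 hs1 hs n) (tsum_pow_natAbs_ne_top hq1))

theorem ENNReal.tsum_prod_fin_eq_pow {ι : Type*} (f : ι → ℝ≥0∞) (m : ℕ) :
    ∑' x : Fin m → ι, ∏ i, f (x i) = (∑' a, f a) ^ m := by
  induction m with
  | zero => simp
  | succ m ih =>
    rw [← (Fin.consEquiv fun _ => ι).tsum_eq, ENNReal.tsum_prod', pow_succ']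
    simp [Fin.consEquiv, Fin.prod_univ_succ, ENNReal.tsum_mul_left, ENNReal.tsum_mul_right, ih]

theorem Matrix.enorm_det_le_prod_sum {ι : Type*} [Fintype ι] [DecidableEq ι]
    (A : Matrix ι ι ℂ) : ‖A.det‖ₑ ≤ ∏ i, ∑ j, ‖A i j‖ₑ := by
  rw [← Matrix.det_transpose, Matrix.det_apply']
  refine (enorm_sum_le _ _).trans ?_
  rw [Finset.prod_univ_sum, Fintype.piFinset_univ]
  calc _ = ∑ π : Equiv.Perm ι, ∏ i, ‖A i (π i)‖ₑ := by
        refine Finset.sum_congr rfl fun π _ => ?_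
        rw [enorm_mul]
        simp only [Matrix.transpose_apply]
        have h1 : ‖((Equiv.Perm.sign π : ℤ) : ℂ)‖ₑ = 1 := by
          rcases Int.units_eq_one_or (Equiv.Perm.sign π) with h | h <;> simp [h]
        rw [h1, one_mul]
        simp only [enorm_eq_nnnorm, nnnorm_prod, ENNReal.ofNNReal_finsetProd]
    _ = ∑ p ∈ Finset.univ.map ⟨fun π : Equiv.Perm ι => (π : ι → ι), DFunLike.coe_injective⟩,
          ∏ i, ‖A i (p i)‖ₑ := by simp
    _ ≤ _ := Finset.sum_le_sum_of_subset (Finset.subset_univ _)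

theorem enorm_det_kernel_le {ι : Type*} (s : Set ι) (K : ι → ι → ℂ) {m : ℕ} (x : Fin m → s) :
    ‖Matrix.det (Matrix.of fun i j : Fin m => K (x i) (x j))‖ₑ ≤
      ∏ i, ∑' b, ‖K (x i) b‖ₑ := by
  by_cases hx : Function.Injective x
  · refine (Matrix.enorm_det_le_prod_sum _).trans (Finset.prod_le_prod' fun i _ => ?_)
    rw [← tsum_fintype (L := .unconditional _)]
    exact ENNReal.tsum_comp_le_tsum_of_injective (Subtype.val_injective.comp hx)
      fun b => ‖K (x i) b‖ₑ
  · obtain ⟨i, j, hij, hne⟩ := Function.not_injective_iff.1 hx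
    rw [Matrix.det_zero_of_row_eq hne (by ext k; simp [hij])]
    simp

theorem fredholmAbsConv_of_tsum_enorm_ne_top {K : ℤ → ℤ → ℂ} {n : ℤ}
    (hK : ∑' a : {a : ℤ // n ≤ a}, ∑' b : ℤ, ‖K a b‖ₑ ≠ ⊤) : FredholmAbsConv K n := by
  set M : ℝ≥0∞ := ∑' a : {a : ℤ // n ≤ a}, ∑' b : ℤ, ‖K a b‖ₑ
  have hle (m : ℕ) : ∑' x : Fin m → {a : ℤ // n ≤ a},
      ‖Matrix.det (Matrix.of fun i j : Fin m => K (x i) (x j))‖ₑ ≤ M ^ m := by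
    rw [← ENNReal.tsum_prod_fin_eq_pow]
    exact ENNReal.tsum_le_tsum fun x => enorm_det_kernel_le {a : ℤ | n ≤ a} K x
  have hne (m : ℕ) := ne_top_of_le_ne_top (ENNReal.pow_ne_top hK) (hle m)
  refine ⟨fun m => tsum_enorm_ne_top_iff_summable_norm.1 (hne m),
    (Real.summable_pow_div_factorial M.toReal).of_nonneg_of_le
      (fun m => by positivity) fun m => ?_⟩
  rw [div_eq_inv_mul]
  gcongr
  rw [← ENNReal.toReal_pow]
  refine le_trans (le_of_eq ?_) (ENNReal.toReal_mono (ENNReal.pow_ne_top hK) (hle m))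
  rw [ENNReal.tsum_toReal_eq fun _ => enorm_ne_top]
  simp_rw [toReal_enorm]

/-- the Fredholm series of `K_{t,t',σ}` on `ℤ' ∩ (n,∞)` converges
absolutely: `∑_{m ≥ 0} (1/m!) ∑_{x_1,…,x_m > n} |det(K(x_i,x_j))| < ∞`. -/
theorem fredholm_series_abs_conv (R : ℝ) (hR : 1 < R) (t t' : ℕ → ℂ)
    (ht : RSummable R t) (ht' : RSummable R t')
    (σ : ℤ → ℝ) (hσ01 : ∀ k, σ k ∈ Set.Icc (0:ℝ) 1)
    (hσsum : Summable fun k : {k : ℤ // k < 0} => σ k)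
    (n : ℤ) :
    FredholmAbsConv (Kker t t' σ) n := by
  exact fredholmAbsConv_of_tsum_enorm_ne_top
    (tsum_enorm_Kker_ne_top hR ht ht' hσ01 hσsum n)

end
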